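/- For all integers ℓ ≥ 0 and j ≥ 0, the boundary walk counts satisfy the alternating-sum identity a^{0,j}_{2ℓ+1} = Σ_{j_1=0}^{j} (−1)^{j−j_1} · a^{0,j_1}_{2ℓ+2}, and symmetrically, for all i ≥ 0, a^{i,0}_{2ℓ+1} = Σ_{i_1=0}^{i} (−1)^{i−i_1} · a^{i_1,0}_{2ℓ+2}. -/

import Mathlib

/-- The quarter plane `Q₂ = {(a,b) : a ≥ 0, b ≥ 0}`. -/
def Q2 : Set (ℤ × ℤ) := {p | 0 ≤ p.1 ∧ 0 ≤ p.2}

/-- The Weyl chamber `W₂ = {(a,b) : a > b ≥ 0}`. -/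
def W2 : Set (ℤ × ℤ) := {p | p.2 < p.1 ∧ 0 ≤ p.2}

/-- A "down" step: `(-1,0)`, `(0,-1)` or `(0,0)`. -/
def DownStep (d : ℤ × ℤ) : Prop := d = (-1, 0) ∨ d = (0, -1) ∨ d = (0, 0)

/-- An "up" step: `(1,0)`, `(0,1)` or `(0,0)`. -/
def UpStep (d : ℤ × ℤ) : Prop := d = (1, 0) ∨ d = (0, 1) ∨ d = (0, 0)

/-- A `𝒫_D`-walk of length `s`: starts at `(1,0)`, stays in `D`, odd steps are
down steps, even steps are up steps.  (The walk is encoded as a function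
`ℕ → ℤ × ℤ` which is constant from index `s` on.) -/
def IsPWalk (D : Set (ℤ × ℤ)) (s : ℕ) (w : ℕ → ℤ × ℤ) : Prop :=
  w 0 = (1, 0) ∧ (∀ r ≤ s, w r ∈ D) ∧
  (∀ r, 1 ≤ r → r ≤ s → r % 2 = 1 → DownStep (w r - w (r - 1))) ∧
  (∀ r, 1 ≤ r → r ≤ s → r % 2 = 0 → UpStep (w r - w (r - 1))) ∧
  (∀ r, s ≤ r → w r = w s)

/-- A `ℬ_D`-walk of length `s`: starts at `(1,0)`, stays in `D`, odd steps are
up steps, even steps are down steps. -/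
def IsBWalk (D : Set (ℤ × ℤ)) (s : ℕ) (w : ℕ → ℤ × ℤ) : Prop :=
  w 0 = (1, 0) ∧ (∀ r ≤ s, w r ∈ D) ∧
  (∀ r, 1 ≤ r → r ≤ s → r % 2 = 1 → UpStep (w r - w (r - 1))) ∧
  (∀ r, 1 ≤ r → r ≤ s → r % 2 = 0 → DownStep (w r - w (r - 1))) ∧
  (∀ r, s ≤ r → w r = w s)

/-- `a^{i,j}_s`: the number of `𝒫_{Q₂}`-walks of length `s` ending at `p`. -/
noncomputable def aQ (s : ℕ) (p : ℤ × ℤ) : ℕ :=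
  Nat.card {w : ℕ → ℤ × ℤ // IsPWalk Q2 s w ∧ w s = p}

/-- `ω^{i,j}_s`: the number of `𝒫_{W₂}`-walks of length `s` ending at `p`. -/
noncomputable def omegaW (s : ℕ) (p : ℤ × ℤ) : ℕ :=
  Nat.card {w : ℕ → ℤ × ℤ // IsPWalk W2 s w ∧ w s = p}

/-- `σ^{i,j}_s`: the number of `ℬ_{W₂}`-walks of length `s` ending at `p`. -/
noncomputable def sigmaB (s : ℕ) (p : ℤ × ℤ) : ℕ :=
  Nat.card {w : ℕ → ℤ × ℤ // IsBWalk W2 s w ∧ w s = p}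

/-- No index `q ≥ 1` with steps `w_{2q-1} - w_{2q-2} = (1,0)` and
`w_{2q} - w_{2q-1} = (-1,0)`. -/
def NoUpDownPair (s : ℕ) (w : ℕ → ℤ × ℤ) : Prop :=
  ∀ q, 1 ≤ q → 2 * q ≤ s →
    ¬ (w (2 * q - 1) - w (2 * q - 2) = (1, 0) ∧ w (2 * q) - w (2 * q - 1) = (-1, 0))

/-- A `ℬ*_{W₂}`-walk. -/
def IsBStarWalk (s : ℕ) (w : ℕ → ℤ × ℤ) : Prop :=
  IsBWalk W2 s w ∧ NoUpDownPair s w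

/-- `σ*^{i,j}_s`: the number of `ℬ*_{W₂}`-walks of length `s` ending at `p`. -/
noncomputable def sigmaStar (s : ℕ) (p : ℤ × ℤ) : ℕ :=
  Nat.card {w : ℕ → ℤ × ℤ // IsBStarWalk s w ∧ w s = p}

/-- The walk that agrees with `w` up to time `s` and is constant from then on. -/
def truncateWalk (s : ℕ) (w : ℕ → ℤ × ℤ) : ℕ → ℤ × ℤ := fun r => w (min r s)

/-- The walk that agrees with `w` up to time `s` and sits at `p` afterwards. -/
def extendWalk (s : ℕ) (p : ℤ × ℤ) (w : ℕ → ℤ × ℤ) : ℕ → ℤ × ℤ :=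
  fun r => if r ≤ s then w r else p

lemma IsPWalk.truncate {D : Set (ℤ × ℤ)} {s : ℕ} {w : ℕ → ℤ × ℤ} (h : IsPWalk D (s + 1) w) :
    IsPWalk D s (truncateWalk s w) := by
  obtain ⟨h0, hD, hodd, heven, -⟩ := h
  refine ⟨by simpa [truncateWalk] using h0, fun r hr => hD _ (by omega), fun r h1 hr h2 => ?_,
    fun r h1 hr h2 => ?_, fun r hr => by simp [truncateWalk, hr]⟩
  · simpa [truncateWalk, hr, (r.sub_le 1).trans hr] using hodd r h1 (by omega) h2
  · simpa [truncateWalk, hr, (r.sub_le 1).trans hr] using heven r h1 (by omega) h2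

lemma IsPWalk.extend {D : Set (ℤ × ℤ)} {s : ℕ} {p : ℤ × ℤ} {w : ℕ → ℤ × ℤ} (h : IsPWalk D s w)
    (hp : p ∈ D) (hs : s % 2 = 1) (hstep : UpStep (p - w s)) :
    IsPWalk D (s + 1) (extendWalk s p w) := by
  obtain ⟨h0, hD, hodd, heven, -⟩ := h
  refine ⟨by simpa [extendWalk] using h0, fun r hr => ?_, fun r h1 hr h2 => ?_,
    fun r h1 hr h2 => ?_, fun r hr => ?_⟩
  · by_cases hrs : r ≤ s
    · simpa [extendWalk, hrs] using hD r hrs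
    · simpa [extendWalk, hrs] using hp
  · have hrs : r ≤ s := by omega
    simpa [extendWalk, hrs, (r.sub_le 1).trans hrs] using hodd r h1 hrs h2
  · by_cases hrs : r ≤ s
    · simpa [extendWalk, hrs, (r.sub_le 1).trans hrs] using heven r h1 hrs h2
    · obtain rfl : r = s + 1 := by omega
      simpa [extendWalk] using hstep
  · simp [extendWalk, show ¬ r ≤ s by omega]

lemma extendWalk_truncateWalk {D : Set (ℤ × ℤ)} {s : ℕ} {w : ℕ → ℤ × ℤ}
    (h : IsPWalk D (s + 1) w) : extendWalk s (w (s + 1)) (truncateWalk s w) = w := by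
  funext r
  by_cases hrs : r ≤ s
  · simp [extendWalk, truncateWalk, hrs]
  · simpa [extendWalk, hrs] using (h.2.2.2.2 r (by omega)).symm

lemma truncateWalk_extendWalk {D : Set (ℤ × ℤ)} {s : ℕ} {w : ℕ → ℤ × ℤ} (h : IsPWalk D s w)
    (p : ℤ × ℤ) : truncateWalk s (extendWalk s p w) = w := by
  funext r
  by_cases hrs : r ≤ s
  · simp [extendWalk, truncateWalk, hrs]
  · simpa [extendWalk, truncateWalk, le_of_not_ge hrs] using (h.2.2.2.2 r (by omega)).symm

lemma finite_setOf_isPWalk (D : Set (ℤ × ℤ)) (s : ℕ) : {w | IsPWalk D s w}.Finite := by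
  induction s with
  | zero =>
    refine (Set.finite_singleton (fun _ => ((1 : ℤ), (0 : ℤ)))).subset fun w hw => ?_
    funext r
    rw [hw.2.2.2.2 r r.zero_le, hw.1]
  | succ s ih =>
    have hfin := ih.prod
      (Set.toFinite ({(-1, 0), (0, -1), (0, 0), (1, 0), (0, 1)} : Set (ℤ × ℤ)))
    refine (hfin.image fun x => extendWalk s (x.1 s + x.2) x.1).subset fun w hw => ?_
    refine ⟨(truncateWalk s w, w (s + 1) - w s), ⟨hw.truncate, ?_⟩, ?_⟩
    · rcases Nat.mod_two_eq_zero_or_one (s + 1) with h | h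
      · have := hw.2.2.2.1 (s + 1) (by omega) le_rfl h
        simp only [UpStep, Nat.add_sub_cancel] at this
        simp only [Set.mem_insert_iff, Set.mem_singleton_iff]
        tauto
      · have := hw.2.2.1 (s + 1) (by omega) le_rfl h
        simp only [DownStep, Nat.add_sub_cancel] at this
        simp only [Set.mem_insert_iff, Set.mem_singleton_iff]
        tauto
    · have : truncateWalk s w s + (w (s + 1) - w s) = w (s + 1) := by simp [truncateWalk]
      simp only [this, extendWalk_truncateWalk hw]

lemma aQ_eq_ncard (s : ℕ) (p : ℤ × ℤ) : aQ s p = {w | IsPWalk Q2 s w ∧ w s = p}.ncard := rfl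

lemma aQ_eq_zero {s : ℕ} {p : ℤ × ℤ} (hp : p ∉ Q2) : aQ s p = 0 := by
  rw [aQ_eq_ncard, Set.ncard_eq_zero ((finite_setOf_isPWalk Q2 s).subset fun _ h => h.1),
    Set.eq_empty_iff_forall_notMem]
  rintro w ⟨hw, rfl⟩
  exact hp (hw.2.1 s le_rfl)

lemma aQ_succ_eq_ncard {s : ℕ} {p : ℤ × ℤ} (hs : s % 2 = 1) (hp : p ∈ Q2) :
    aQ (s + 1) p = {w | IsPWalk Q2 s w ∧ UpStep (p - w s)}.ncard := by
  rw [aQ_eq_ncard]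
  refine Set.ncard_congr (fun w _ => truncateWalk s w) ?_ ?_ ?_
  · rintro w ⟨hw, rfl⟩
    refine ⟨hw.truncate, ?_⟩
    simpa [truncateWalk] using hw.2.2.2.1 (s + 1) (by omega) le_rfl (by omega)
  · rintro w w' ⟨hw, hwp⟩ ⟨hw', hwp'⟩ h
    rw [← extendWalk_truncateWalk hw, ← extendWalk_truncateWalk hw', hwp, hwp', h]
  · rintro w ⟨hw, hstep⟩
    exact ⟨extendWalk s p w, ⟨hw.extend hp hs hstep, by simp [extendWalk]⟩,
      truncateWalk_extendWalk hw p⟩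

/-- The last step of a walk of even length is an up step. -/
lemma aQ_succ {s : ℕ} {p : ℤ × ℤ} (hs : s % 2 = 1) (hp : p ∈ Q2) :
    aQ (s + 1) p = aQ s p + aQ s (p - (1, 0)) + aQ s (p - (0, 1)) := by
  have hfin (q : ℤ × ℤ) : {w | IsPWalk Q2 s w ∧ w s = q}.Finite :=
    (finite_setOf_isPWalk Q2 s).subset fun _ h => h.1
  have hsplit : {w | IsPWalk Q2 s w ∧ UpStep (p - w s)} =
      {w | IsPWalk Q2 s w ∧ w s = p} ∪ {w | IsPWalk Q2 s w ∧ w s = p - (1, 0)} ∪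
        {w | IsPWalk Q2 s w ∧ w s = p - (0, 1)} := by
    ext w
    simp only [UpStep, Set.mem_ofPred_eq, Set.mem_union, Prod.ext_iff, Prod.fst_sub, Prod.snd_sub]
    grind
  rw [aQ_succ_eq_ncard hs hp, hsplit, Set.ncard_union_eq _ ((hfin _).union (hfin _)) (hfin _),
    Set.ncard_union_eq _ (hfin _) (hfin _)]
  · rfl
  · refine Set.disjoint_left.2 fun w h h' => ?_
    have := h.2.symm.trans h'.2
    simp only [Prod.ext_iff, Prod.fst_sub, Prod.snd_sub] at this
    omega
  · rw [Set.disjoint_union_left]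
    constructor <;>
    · refine Set.disjoint_left.2 fun w h h' => ?_
      have := h.2.symm.trans h'.2
      simp only [Prod.ext_iff, Prod.fst_sub, Prod.snd_sub] at this
      omega

/-- Inversion of `b n = a n + a (n - 1)` by an alternating sum. -/
lemma eq_sum_neg_one_pow_mul {R : Type*} [CommRing R] {a b : ℕ → R} (h0 : b 0 = a 0)
    (hsucc : ∀ n, b (n + 1) = a (n + 1) + a n) (n : ℕ) :
    a n = ∑ k ∈ Finset.range (n + 1), (-1) ^ (n - k) * b k := by
  induction n with
  | zero => simp [h0]
  | succ n ih =>
    have hsum : ∑ k ∈ Finset.range (n + 1), (-1) ^ (n + 1 - k) * b k = -a n := by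
      rw [ih, ← Finset.sum_neg_distrib]
      refine Finset.sum_congr rfl fun k hk => ?_
      rw [Nat.succ_sub (Finset.mem_range_succ_iff.1 hk), pow_succ]
      ring
    rw [Finset.sum_range_succ, hsum, hsucc]
    simp

/-- Alternating-sum identities for boundary walk counts: for `ℓ, j, i ≥ 0`,
`a^{0,j}_{2ℓ+1} = Σ_{j₁=0}^{j} (-1)^{j-j₁} a^{0,j₁}_{2ℓ+2}` and
`a^{i,0}_{2ℓ+1} = Σ_{i₁=0}^{i} (-1)^{i-i₁} a^{i₁,0}_{2ℓ+2}`. -/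
theorem boundary_alternating_sum (ℓ : ℕ) (i j : ℕ) :
    (aQ (2 * ℓ + 1) (0, (j : ℤ)) : ℤ)
        = ∑ j1 ∈ Finset.range (j + 1),
            (-1 : ℤ) ^ (j - j1) * (aQ (2 * ℓ + 2) (0, (j1 : ℤ)) : ℤ) ∧
    (aQ (2 * ℓ + 1) ((i : ℤ), 0) : ℤ)
        = ∑ i1 ∈ Finset.range (i + 1),
            (-1 : ℤ) ^ (i - i1) * (aQ (2 * ℓ + 2) ((i1 : ℤ), 0) : ℤ) := by
  have hodd : (2 * ℓ + 1) % 2 = 1 := by omega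
  constructor
  · refine eq_sum_neg_one_pow_mul (a := fun n : ℕ => (aQ (2 * ℓ + 1) (0, (n : ℤ)) : ℤ))
      (b := fun n : ℕ => (aQ (2 * ℓ + 2) (0, (n : ℤ)) : ℤ)) ?_ (fun n => ?_) j
    · simp [aQ_succ (p := (0, 0)) hodd (by simp [Q2]), aQ_eq_zero, Q2]
    · have hn : (0 : ℤ) ≤ n + 1 := by positivity
      simp [aQ_succ (p := (0, (n : ℤ) + 1)) hodd (by simp [Q2, hn]), aQ_eq_zero, Q2]
  · refine eq_sum_neg_one_pow_mul (a := fun n : ℕ => (aQ (2 * ℓ + 1) ((n : ℤ), 0) : ℤ))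
      (b := fun n : ℕ => (aQ (2 * ℓ + 2) ((n : ℤ), 0) : ℤ)) ?_ (fun n => ?_) i
    · simp [aQ_succ (p := (0, 0)) hodd (by simp [Q2]), aQ_eq_zero, Q2]
    · have hn : (0 : ℤ) ≤ n + 1 := by positivity
      simp [aQ_succ (p := ((n : ℤ) + 1, 0)) hodd (by simp [Q2, hn]), aQ_eq_zero, Q2]
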